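/- Let γ>0, σ>0, μ>0, y⋆>0, set α=2μ/σ² and h(y)=γσ²y⋆y−(γσ²/2)y². Then for all sufficiently small ε>0 the system of two equations in (y₋,y₊) with 0<y₋<y⋆<y₊, namely ∫_{y₋}^{y₊}(h(u)−h(y₋))u^{α−2}du=(εσ²/2)·y₊^{α} and ∫_{y₋}^{y₊}(h(u)−h(y₋))u^{α−2}du=(y₊^{α−1}/α)·(h(y₊)−h(y₋)), has a unique solution (y₋(ε),y₊(ε)), and as ε→0⁺ it satisfies y₊(ε)=y⋆+(3y⋆²/(4γ))^{1/3}ε^{1/3}−(γy⋆/6)^{1/3}·(μ/(γσ²))·ε^{2/3}+O(ε) and y₋(ε)=y⋆−(3y⋆²/(4γ))^{1/3}ε^{1/3}−(γy⋆/6)^{1/3}·(μ/(γσ²))·ε^{2/3}+O(ε). -/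

import Mathlib

open Filter Asymptotics Topology

/-- The quadratic penalty `h(y) = γσ²y⋆y - (γσ²/2)y²` of the log-contract hedging
problem. -/
noncomputable def hFun (γ σ ystar y : ℝ) : ℝ :=
  γ * σ ^ 2 * ystar * y - γ * σ ^ 2 / 2 * y ^ 2

/-- The integral `∫_{a}^{b} (h(u) - h(a)) u^{α-2} du` with `α = 2μ/σ²`. -/
noncomputable def hInt (γ σ μ ystar a b : ℝ) : ℝ :=
  ∫ u in a..b, (hFun γ σ ystar u - hFun γ σ ystar a) * u ^ (2 * μ / σ ^ 2 - 2)

/-- The normalised gap integral `∫_{a}^{b} (h(u) - h(a)) u^{α-2} du` for the quadratic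
`h(u) = 2cu - u²`. -/
noncomputable def gapInt (α c a b : ℝ) : ℝ :=
  ∫ u in a..b, (u - a) * (2 * c - a - u) * u ^ (α - 2)

/-- The numerator of the derivative of `y ↦ y^{-α} ∫_{a}^{y} (h(u) - h(a)) u^{α-2} du`. -/
noncomputable def slopeFun (α c a y : ℝ) : ℝ :=
  y ^ (α - 1) * ((y - a) * (2 * c - a - y)) - α * gapInt α c a y

theorem continuousOn_mul_rpow {f : ℝ → ℝ} (hf : Continuous f) (r : ℝ) :
    ContinuousOn (fun u : ℝ => f u * u ^ r) (Set.Ioi 0) :=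
  hf.continuousOn.mul fun _ hu =>
    (Real.continuousAt_rpow_const _ _ (Or.inl (ne_of_gt hu))).continuousWithinAt

theorem uIcc_subset_Ioi_zero {a b : ℝ} (ha : 0 < a) (hb : 0 < b) :
    Set.uIcc a b ⊆ Set.Ioi (0 : ℝ) := fun _ hx => lt_of_lt_of_le (lt_min ha hb) hx.1

theorem intervalIntegrable_mul_rpow {f : ℝ → ℝ} (hf : Continuous f) (r : ℝ) {a b : ℝ}
    (ha : 0 < a) (hb : 0 < b) :
    IntervalIntegrable (fun u : ℝ => f u * u ^ r) MeasureTheory.volume a b :=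
  ((continuousOn_mul_rpow hf r).mono (uIcc_subset_Ioi_zero ha hb)).intervalIntegrable

theorem hasDerivAt_integral_mul_rpow {f : ℝ → ℝ} (hf : Continuous f) (r : ℝ) {a b : ℝ}
    (ha : 0 < a) (hb : 0 < b) :
    HasDerivAt (fun y => ∫ u in a..y, f u * u ^ r) (f b * b ^ r) b :=
  intervalIntegral.integral_hasDerivAt_right (intervalIntegrable_mul_rpow hf r ha hb)
    ((continuousOn_mul_rpow hf r).stronglyMeasurableAtFilter isOpen_Ioi b hb)
    ((continuousOn_mul_rpow hf r).continuousAt (Ioi_mem_nhds hb))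

theorem hasDerivAt_gapInt (α c : ℝ) {a b : ℝ} (ha : 0 < a) (hb : 0 < b) :
    HasDerivAt (gapInt α c a) ((b - a) * (2 * c - a - b) * b ^ (α - 2)) b :=
  hasDerivAt_integral_mul_rpow (f := fun u => (u - a) * (2 * c - a - u)) (by fun_prop) _ ha hb

theorem gapInt_sub_gapInt (α c : ℝ) {a₁ a₂ b : ℝ} (h₁ : 0 < a₁) (h₂ : 0 < a₂) (hb : 0 < b) :
    gapInt α c a₁ b - gapInt α c a₂ b =
      gapInt α c a₁ a₂ + (a₂ - a₁) * (2 * c - a₁ - a₂) * ∫ u in a₂..b, u ^ (α - 2) := by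
  have hi {x y : ℝ} (a : ℝ) (hx : 0 < x) (hy : 0 < y) :=
    intervalIntegrable_mul_rpow (f := fun u => (u - a) * (2 * c - a - u)) (by fun_prop)
      (α - 2) hx hy
  unfold gapInt
  rw [← intervalIntegral.integral_add_adjacent_intervals (hi a₁ h₁ h₂) (hi a₁ h₂ hb),
    add_sub_assoc, ← intervalIntegral.integral_sub (hi a₁ h₂ hb) (hi a₂ h₂ hb),
    ← intervalIntegral.integral_const_mul]
  congr 1
  refine intervalIntegral.integral_congr fun u _ => ?_
  ring

theorem gapInt_pos (α : ℝ) {c a b : ℝ} (ha : 0 < a) (hab : a < b) (hb : b ≤ 2 * c - a) :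
    0 < gapInt α c a b := by
  refine intervalIntegral.intervalIntegral_pos_of_pos_on
    (intervalIntegrable_mul_rpow (f := fun u => (u - a) * (2 * c - a - u)) (by fun_prop) _ ha
      (ha.trans hab)) (fun u hu => ?_) hab
  exact mul_pos (mul_pos (by linarith [hu.1]) (by linarith [hu.2]))
    (Real.rpow_pos_of_pos (ha.trans hu.1) _)

theorem gapInt_lt_gapInt (α : ℝ) {c a₁ a₂ b : ℝ} (h₁ : 0 < a₁) (h₁₂ : a₁ < a₂) (h₂ : a₂ ≤ c)
    (hb : c ≤ b) : gapInt α c a₂ b < gapInt α c a₁ b := by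
  have h0 : 0 < a₂ := h₁.trans h₁₂
  have hpos : 0 ≤ ∫ u in a₂..b, u ^ (α - 2) :=
    intervalIntegral.integral_nonneg (h₂.trans hb) fun u hu =>
      Real.rpow_nonneg (h0.le.trans hu.1) _
  have := gapInt_sub_gapInt α c h₁ h0 (h0.trans_le (h₂.trans hb))
  have := gapInt_pos α (c := c) h₁ h₁₂ (by linarith)
  nlinarith [mul_nonneg (mul_nonneg (sub_pos.2 h₁₂).le
    (by linarith : 0 ≤ 2 * c - a₁ - a₂)) hpos]

theorem gapInt_self_nonpos (α : ℝ) {c b : ℝ} (hc : 0 < c) (hb : c ≤ b) :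
    gapInt α c c b ≤ 0 := by
  have : 0 ≤ ∫ u in c..b, (u - c) ^ 2 * u ^ (α - 2) :=
    intervalIntegral.integral_nonneg hb fun u hu =>
      mul_nonneg (sq_nonneg _) (Real.rpow_nonneg (hc.le.trans hu.1) _)
  have h : gapInt α c c b = -∫ u in c..b, (u - c) ^ 2 * u ^ (α - 2) := by
    rw [← intervalIntegral.integral_neg]
    refine intervalIntegral.integral_congr fun u _ => ?_
    ring
  linarith

theorem continuousOn_gapInt (α : ℝ) {c : ℝ} (hc : 0 < c) :
    ContinuousOn (fun z : ℝ × ℝ => gapInt α c z.1 z.2) (Set.Ioi 0 ×ˢ Set.Ioi 0) := by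
  set P : ℝ → ℝ := gapInt α c c
  set Q : ℝ → ℝ := fun y => ∫ u in c..y, (1 : ℝ) * u ^ (α - 2)
  have hP : ContinuousOn P (Set.Ioi 0) := fun y hy =>
    (hasDerivAt_gapInt α c hc hy).continuousAt.continuousWithinAt
  have hQ : ContinuousOn Q (Set.Ioi 0) := fun y hy =>
    (hasDerivAt_integral_mul_rpow (f := fun _ => 1) continuous_const (α - 2) hc
      hy).continuousAt.continuousWithinAt
  have h1 : Set.MapsTo (Prod.fst : ℝ × ℝ → ℝ) (Set.Ioi 0 ×ˢ Set.Ioi 0) (Set.Ioi 0) :=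
    fun z hz => hz.1
  have h2 : Set.MapsTo (Prod.snd : ℝ × ℝ → ℝ) (Set.Ioi 0 ×ˢ Set.Ioi 0) (Set.Ioi 0) :=
    fun z hz => hz.2
  have hP1 := hP.comp continuousOn_fst h1
  have hP2 := hP.comp continuousOn_snd h2
  have hQ1 := hQ.comp continuousOn_fst h1
  have hQ2 := hQ.comp continuousOn_snd h2
  refine ((hP2.sub hP1).add (((by fun_prop : ContinuousOn (fun z : ℝ × ℝ => (z.1 - c) ^ 2) _)).mul
    (hQ2.sub hQ1))).congr fun z hz => ?_
  have ha : 0 < z.1 := hz.1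
  have hb : 0 < z.2 := hz.2
  have hi {x y : ℝ} (hx : 0 < x) (hy : 0 < y) :=
    intervalIntegrable_mul_rpow (f := fun _ => 1) continuous_const (α - 2) hx hy
  have e1 := gapInt_sub_gapInt α c hc ha hb
  have e2 : Q z.2 - Q z.1 = ∫ u in z.1..z.2, u ^ (α - 2) := by
    simp only [Q]
    rw [intervalIntegral.integral_interval_sub_left (hi hc hb) (hi hc ha)]
    simp
  simp only [Pi.sub_apply, Pi.add_apply, Pi.mul_apply, Function.comp_apply, e2]
  linear_combination -e1

theorem hasDerivAt_slopeFun (α c : ℝ) {a y : ℝ} (ha : 0 < a) (hy : 0 < y) :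
    HasDerivAt (slopeFun α c a) (y ^ (α - 2) * (2 * c * a - a ^ 2 - y ^ 2)) y := by
  have h1 := Real.hasDerivAt_rpow_const (p := α - 1) (Or.inl hy.ne')
  have h2 : HasDerivAt (fun y => (y - a) * (2 * c - a - y)) (2 * c - 2 * y) y := by
    have := ((hasDerivAt_id y).sub_const a).mul ((hasDerivAt_id y).const_sub (2 * c - a))
    convert! this using 1
    simp only [id]
    ring
  have h3 := (h1.mul h2).sub ((hasDerivAt_gapInt α c ha hy).const_mul α)
  convert! h3 using 1
  have e : y ^ (α - 1) = y ^ (α - 2) * y := by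
    rw [← Real.rpow_add_one hy.ne']
    ring_nf
  rw [show α - 1 - 1 = α - 2 by ring, e]
  ring

theorem slopeFun_strictAntiOn (α : ℝ) {c a : ℝ} (ha : 0 < a) (hac : a < c) :
    StrictAntiOn (slopeFun α c a) (Set.Ici c) := by
  have hc := ha.trans hac
  refine strictAntiOn_of_deriv_neg (convex_Ici c) (fun y hy =>
    (hasDerivAt_slopeFun α c ha (hc.trans_le hy)).continuousAt.continuousWithinAt) fun y hy => ?_
  rw [interior_Ici] at hy
  have hcy : c < y := hy
  rw [(hasDerivAt_slopeFun α c ha (hc.trans hcy)).deriv]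
  refine mul_neg_of_pos_of_neg (Real.rpow_pos_of_pos (hc.trans hcy) _) ?_
  nlinarith [sq_nonneg (a - c), mul_pos (sub_pos.2 hcy) (hc.trans hcy)]

theorem hasDerivAt_rpow_neg_mul_gapInt (α c : ℝ) {a y : ℝ} (ha : 0 < a) (hy : 0 < y) :
    HasDerivAt (fun y => y ^ (-α) * gapInt α c a y) (y ^ (-α - 1) * slopeFun α c a y) y := by
  have h := (Real.hasDerivAt_rpow_const (p := -α) (Or.inl hy.ne')).mul
    (hasDerivAt_gapInt α c ha hy)
  convert! h using 1
  have e : y ^ (-α) * y ^ (α - 2) = y ^ (-α - 1) * y ^ (α - 1) := by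
    rw [← Real.rpow_add hy, ← Real.rpow_add hy]
    ring_nf
  simp only [slopeFun]
  linear_combination -((y - a) * (2 * c - a - y)) * e

theorem rpow_neg_mul_gapInt_le (α : ℝ) {c a b y : ℝ} (ha : 0 < a) (hac : a < c) (hb : c ≤ b)
    (hs : slopeFun α c a b = 0) (hy : c ≤ y) :
    y ^ (-α) * gapInt α c a y ≤ b ^ (-α) * gapInt α c a b := by
  have hc := ha.trans hac
  have hanti := slopeFun_strictAntiOn α ha hac
  have hd {x : ℝ} (hx : c ≤ x) := hasDerivAt_rpow_neg_mul_gapInt α c ha (hc.trans_le hx)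
  rcases le_total y b with hyb | hyb
  · refine monotoneOn_of_deriv_nonneg (convex_Icc c b)
      (fun x hx => (hd hx.1).continuousAt.continuousWithinAt)
      (fun x hx => (hd (interior_subset hx).1).differentiableAt.differentiableWithinAt)
      (fun x hx => ?_) ⟨hy, hyb⟩ ⟨hb, le_rfl⟩ hyb
    have hx' := interior_subset hx
    rw [(hd hx'.1).deriv]
    refine mul_nonneg (Real.rpow_nonneg (hc.le.trans hx'.1) _) ?_
    rw [← hs]
    exact hanti.antitoneOn hx'.1 hb hx'.2
  · refine antitoneOn_of_deriv_nonpos (convex_Ici b)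
      (fun x hx => (hd (hb.trans hx)).continuousAt.continuousWithinAt)
      (fun x hx => (hd (hb.trans (interior_subset hx))).differentiableAt.differentiableWithinAt)
      (fun x hx => ?_) (Set.mem_Ici.2 le_rfl) hyb hyb
    have hx' : b ≤ x := interior_subset hx
    rw [(hd (hb.trans hx')).deriv]
    refine mul_nonpos_of_nonneg_of_nonpos (Real.rpow_nonneg (hc.le.trans (hb.trans hx')) _) ?_
    rw [← hs]
    exact hanti.antitoneOn hb (hb.trans hx') hx'

theorem rpow_neg_mul_gapInt_lt (α : ℝ) {c a₁ a₂ b₁ b₂ : ℝ} (h₁ : 0 < a₁) (h₁₂ : a₁ < a₂)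
    (h₂ : a₂ ≤ c) (hb₁ : c ≤ b₁) (hb₂ : c ≤ b₂) (hs : slopeFun α c a₁ b₁ = 0) :
    b₂ ^ (-α) * gapInt α c a₂ b₂ < b₁ ^ (-α) * gapInt α c a₁ b₁ :=
  (mul_lt_mul_of_pos_left (gapInt_lt_gapInt α h₁ h₁₂ h₂ hb₂)
    (Real.rpow_pos_of_pos (h₁.trans_le (h₁₂.le.trans (h₂.trans hb₂))) _)).trans_le
    (rpow_neg_mul_gapInt_le α h₁ (h₁₂.trans_le h₂) hb₁ hs hb₂)

theorem eq_of_slopeFun_eq_zero (α : ℝ) {c a₁ a₂ b₁ b₂ : ℝ} (h₁ : 0 < a₁) (h₁c : a₁ < c)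
    (h₂ : 0 < a₂) (h₂c : a₂ < c) (hb₁ : c < b₁) (hb₂ : c < b₂)
    (hs₁ : slopeFun α c a₁ b₁ = 0) (hs₂ : slopeFun α c a₂ b₂ = 0)
    (h : b₁ ^ (-α) * gapInt α c a₁ b₁ = b₂ ^ (-α) * gapInt α c a₂ b₂) :
    a₁ = a₂ ∧ b₁ = b₂ := by
  have ha : a₁ = a₂ := by
    rcases lt_trichotomy a₁ a₂ with hlt | heq | hgt
    · exact absurd h (rpow_neg_mul_gapInt_lt α h₁ hlt h₂c.le hb₁.le hb₂.le hs₁).ne'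
    · exact heq
    · exact absurd h (rpow_neg_mul_gapInt_lt α h₂ hgt h₁c.le hb₂.le hb₁.le hs₂).ne
  subst ha
  exact ⟨rfl, (slopeFun_strictAntiOn α h₁ h₁c).injOn hb₁.le hb₂.le (hs₁.trans hs₂.symm)⟩

theorem exists_slopeFun_eq_zero {α c a : ℝ} (hα : 0 < α) (ha : 0 < a) (hac : a < c)
    (h : 0 < slopeFun α c a c) :
    ∃ b, c < b ∧ b < 2 * c - a ∧ slopeFun α c a b = 0 := by
  have hc := ha.trans hac
  have hneg : slopeFun α c a (2 * c - a) < 0 := by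
    have := gapInt_pos α (c := c) ha (b := 2 * c - a) (by linarith) le_rfl
    simp only [slopeFun, sub_self, mul_zero, zero_sub]
    nlinarith
  obtain ⟨b, hb, hb0⟩ := intermediate_value_Ioo' (by linarith : c ≤ 2 * c - a)
    (fun y hy => (hasDerivAt_slopeFun α c ha
      (hc.trans_le hy.1)).continuousAt.continuousWithinAt) ⟨hneg, h⟩
  exact ⟨b, hb.1, hb.2, hb0⟩

theorem exists_solution_of_slopeFun_pos {α c ρ η : ℝ} (hα : 0 < α) (hρ : 0 < ρ) (hρc : ρ < c)
    (hslope : ∀ a, c - ρ ≤ a → a < c → 0 < slopeFun α c a c) (hη : 0 < η)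
    (hη' : η ≤ c ^ (-α) * gapInt α c (c - ρ) c) :
    ∃ a b, c - ρ ≤ a ∧ a < c ∧ c < b ∧ slopeFun α c a b = 0 ∧
      b ^ (-α) * gapInt α c a b = η := by
  have hc := hρ.trans hρc
  set V : ℝ × ℝ → ℝ := fun z => z.2 ^ (-α) * gapInt α c z.1 z.2 with hV
  have hVc : ContinuousOn V (Set.Ioi 0 ×ˢ Set.Ioi 0) :=
    (continuousOn_snd.rpow_const fun z hz => Or.inl (ne_of_gt hz.2)).mul
      (continuousOn_gapInt α hc)
  set K : Set (ℝ × ℝ) := Set.Icc (c - ρ) c ×ˢ Set.Icc c (2 * c) with hK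
  have hKsub : K ⊆ Set.Ioi 0 ×ˢ Set.Ioi 0 := fun z hz =>
    ⟨lt_of_lt_of_le (by linarith : 0 < c - ρ) hz.1.1, hc.trans_le hz.2.1⟩
  have hKc : IsCompact K := isCompact_Icc.prod isCompact_Icc
  have hS : IsCompact (K ∩ V ⁻¹' Set.Ici η) :=
    hKc.of_isClosed_subset ((hVc.mono hKsub).preimage_isClosed_of_isClosed hKc.isClosed
      isClosed_Ici) Set.inter_subset_left
  obtain ⟨⟨a, y⟩, ⟨⟨ha, hy⟩, hVay⟩, hmax⟩ := hS.exists_isMaxOn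
    ⟨(c - ρ, c), ⟨⟨⟨le_rfl, by simp only; linarith⟩, ⟨le_rfl, by simp only; linarith⟩⟩, hη'⟩⟩
    continuousOn_fst
  simp only at ha hy
  have hVay : η ≤ y ^ (-α) * gapInt α c a y := hVay
  have hself {x : ℝ} (hx : c ≤ x) : x ^ (-α) * gapInt α c c x < η :=
    (mul_nonpos_of_nonneg_of_nonpos (Real.rpow_nonneg (hc.le.trans hx) _)
      (gapInt_self_nonpos α hc hx)).trans_lt hη
  have hac : a < c := by
    refine lt_of_le_of_ne ha.2 fun h => ?_
    rw [h] at hVay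
    exact absurd hVay (hself hy.1).not_ge
  have ha0 : 0 < a := lt_of_lt_of_le (by linarith) ha.1
  have hle {x : ℝ} (hx : x ∈ Set.Icc c (2 * c)) : x ^ (-α) * gapInt α c a x ≤ η := by
    by_contra! hlt
    have hx0 : 0 < x := hc.trans_le hx.1
    have hcont : ContinuousOn (fun t => V (t, x)) (Set.Icc a c) :=
      hVc.comp (by fun_prop) fun t ht => ⟨ha0.trans_le ht.1, hx0⟩
    obtain ⟨t, ht, hteq⟩ := intermediate_value_Ioo' hac.le hcont ⟨hself hx.1, hlt⟩
    have : t ≤ a := hmax (⟨⟨⟨ha.1.trans ht.1.le, ht.2.le⟩, hx⟩, hteq.ge⟩ :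
      (t, x) ∈ K ∩ V ⁻¹' Set.Ici η)
    exact absurd ht.1 this.not_gt
  obtain ⟨b, hcb, hb, hs⟩ := exists_slopeFun_eq_zero hα ha0 hac (hslope a ha.1 hac)
  exact ⟨a, b, ha.1, hac, hcb, hs, le_antisymm (hle ⟨hcb.le, by linarith⟩)
    (hVay.trans (rpow_neg_mul_gapInt_le α ha0 hac hcb.le hs hy.1))⟩

theorem add_rpow_sub_isBigO {c : ℝ} (hc : 0 < c) (r : ℝ) :
    (fun s : ℝ => (c + s) ^ r - c ^ r - r * c ^ (r - 1) * s) =O[𝓝 0] fun s => s ^ 2 := by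
  have hd (t : ℝ) {s : ℝ} (hs : 0 < c + s) :
      HasDerivAt (fun s : ℝ => (c + s) ^ t) (t * (c + s) ^ (t - 1)) s := by
    simpa using ((hasDerivAt_id s).const_add c).rpow_const (p := t) (Or.inl hs.ne')
  have hO := (((hd (r - 1) (s := 0) (by simpa using hc)).const_mul r)).isBigO_sub
  obtain ⟨C, hC0, hC⟩ := hO.exists_pos
  rw [isBigOWith_iff] at hC
  obtain ⟨ρ, hρ, hball⟩ := Metric.eventually_nhds_iff.1
    (hC.and (lt_mem_nhds (neg_lt_zero.2 hc)))
  refine IsBigO.of_bound C (Metric.eventually_nhds_iff.2 ⟨ρ, hρ, fun s hs => ?_⟩)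
  have hmem {x : ℝ} (hx : x ∈ Set.uIcc 0 s) : |x| ≤ |s| := by
    simpa using Set.abs_sub_left_of_mem_uIcc hx
  have hsρ : |s| < ρ := by simpa using hs
  have key := (convex_uIcc (0 : ℝ) s).norm_image_sub_le_of_norm_hasDerivWithin_le
    (f := fun s => (c + s) ^ r - c ^ r - r * c ^ (r - 1) * s)
    (f' := fun x => r * (c + x) ^ (r - 1) - r * c ^ (r - 1)) (C := C * |s|)
    (fun x hx => ?_) (fun x hx => ?_) Set.left_mem_uIcc Set.right_mem_uIcc
  · simp only [add_zero, sub_self, mul_zero, sub_zero, Real.norm_eq_abs] at key ⊢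
    rw [abs_pow]
    linarith
  · have hx' := hball (y := x) (by simpa using (hmem hx).trans_lt hsρ)
    have h2 : 0 < c + x := by linarith [hx'.2]
    have := (((hd r h2).sub_const (c ^ r)).sub
      ((hasDerivAt_id x).const_mul (r * c ^ (r - 1)))).hasDerivWithinAt (s := Set.uIcc 0 s)
    rw [mul_one] at this
    exact this
  · have hx' := hball (y := x) (by simpa using (hmem hx).trans_lt hsρ)
    have h1 := hx'.1
    simp only [add_zero, sub_zero, Real.norm_eq_abs] at h1 ⊢
    refine h1.trans (mul_le_mul_of_nonneg_left (hmem hx) ?_)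
    exact hC0.le

theorem gapInt_eq_integral_shift (α c p q : ℝ) :
    gapInt α c (c - p) (c + q) = ∫ s in -p..q, (p ^ 2 - s ^ 2) * (c + s) ^ (α - 2) := by
  have h := intervalIntegral.integral_comp_add_left (a := -p) (b := q)
    (fun u => (u - (c - p)) * (2 * c - (c - p) - u) * u ^ (α - 2)) c
  rw [← sub_eq_add_neg] at h
  rw [gapInt, ← h]
  refine intervalIntegral.integral_congr fun s _ => ?_
  ring_nf

theorem exists_gapInt_expansion_bound (α : ℝ) {c : ℝ} (hc : 0 < c) :
    ∃ C > 0, ∃ r > 0, ∀ p q : ℝ, 0 ≤ q → q ≤ p → p ≤ r →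
      |gapInt α c (c - p) (c + q) - (c ^ (α - 2) * (p ^ 2 * q - q ^ 3 / 3 + 2 * p ^ 3 / 3)
        - (α - 2) * c ^ (α - 2 - 1) * (p ^ 2 - q ^ 2) ^ 2 / 4)| ≤ C * p ^ 5 := by
  obtain ⟨C, hC0, hC⟩ := (add_rpow_sub_isBigO hc (α - 2)).exists_pos
  rw [isBigOWith_iff] at hC
  obtain ⟨ρ, hρ, hball⟩ := Metric.eventually_nhds_iff.1 (hC.and (lt_mem_nhds (neg_lt_zero.2 hc)))
  refine ⟨2 * C, by positivity, ρ / 2, by positivity, fun p q hq hqp hpr => ?_⟩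
  have hp : 0 ≤ p := hq.trans hqp
  have hmem {s : ℝ} (h1 : -p ≤ s) (h2 : s ≤ q) : |s| ≤ p := abs_le.2 ⟨h1, h2.trans hqp⟩
  have hb {s : ℝ} (h1 : -p ≤ s) (h2 : s ≤ q) :=
    hball (y := s) (by simpa using lt_of_le_of_lt (hmem h1 h2) (by linarith : p < ρ))
  have hpoly : ∫ s in -p..q, (p ^ 2 - s ^ 2) * (c ^ (α - 2) + (α - 2) * c ^ (α - 2 - 1) * s) =
      c ^ (α - 2) * (p ^ 2 * q - q ^ 3 / 3 + 2 * p ^ 3 / 3)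
        - (α - 2) * c ^ (α - 2 - 1) * (p ^ 2 - q ^ 2) ^ 2 / 4 := by
    generalize c ^ (α - 2) = A
    generalize (α - 2) * c ^ (α - 2 - 1) = B
    have hder (s : ℝ) : HasDerivAt
        (fun s => A * (p ^ 2 * s - s ^ 3 / 3) - B * (p ^ 2 - s ^ 2) ^ 2 / 4)
        ((p ^ 2 - s ^ 2) * (A + B * s)) s := by
      have h1 := ((hasDerivAt_id s).const_mul (p ^ 2)).sub ((hasDerivAt_pow 3 s).div_const 3)
      have h2 := ((hasDerivAt_pow 2 s).const_sub (p ^ 2)).pow 2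
      convert! (h1.const_mul A).sub ((h2.const_mul B).div_const 4) using 1
      simp
      ring
    rw [intervalIntegral.integral_eq_sub_of_hasDerivAt (fun s _ => hder s)
      (Continuous.intervalIntegrable (by fun_prop) _ _)]
    ring
  have hcont : ContinuousOn (fun s : ℝ => (p ^ 2 - s ^ 2) * (c + s) ^ (α - 2))
      (Set.uIcc (-p) q) := by
    rw [Set.uIcc_of_le (by linarith)]
    refine ContinuousOn.mul (by fun_prop) (ContinuousOn.rpow_const (by fun_prop) fun s hs => ?_)
    exact Or.inl (by linarith [(hb hs.1 hs.2).2] : 0 < c + s).ne'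
  rw [gapInt_eq_integral_shift, ← hpoly, ← intervalIntegral.integral_sub
    hcont.intervalIntegrable (Continuous.intervalIntegrable (by fun_prop) _ _), ← Real.norm_eq_abs]
  refine (intervalIntegral.norm_integral_le_of_norm_le_const (C := p ^ 2 * (C * p ^ 2))
    fun s hs => ?_).trans ?_
  · rw [Set.uIoc_of_le (by linarith)] at hs
    have h1 := (hb hs.1.le hs.2).1
    have hsq : s ^ 2 ≤ p ^ 2 := sq_le_sq' hs.1.le (hs.2.trans hqp)
    rw [← mul_sub, norm_mul, ← sub_sub]
    refine mul_le_mul ?_ (h1.trans ?_) (norm_nonneg _) (sq_nonneg p)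
    · rw [Real.norm_eq_abs, abs_le]
      constructor <;> nlinarith [sq_nonneg s]
    · rw [Real.norm_eq_abs, abs_of_nonneg (sq_nonneg s)]
      exact mul_le_mul_of_nonneg_left hsq hC0.le
  · rw [abs_of_nonneg (by linarith)]
    have : q - -p ≤ 2 * p := by linarith
    calc p ^ 2 * (C * p ^ 2) * (q - -p) ≤ p ^ 2 * (C * p ^ 2) * (2 * p) :=
          mul_le_mul_of_nonneg_left this (by positivity)
      _ = 2 * C * p ^ 5 := by ring

theorem exists_slopeFun_pos {α c : ℝ} (hα : 0 < α) (hc : 0 < c) :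
    ∃ r > 0, ∀ a, c - r ≤ a → a < c → 0 < slopeFun α c a c := by
  obtain ⟨C, hC, r, hr, hbound⟩ := exists_gapInt_expansion_bound α hc
  have hlim : Tendsto (fun p : ℝ => c ^ (α - 1) - α * (c ^ (α - 2) * (2 * p / 3)
      - (α - 2) * c ^ (α - 2 - 1) * p ^ 2 / 4 + C * p ^ 3)) (𝓝 0) (𝓝 (c ^ (α - 1))) := by
    refine Continuous.tendsto' (by fun_prop) _ _ (by simp)
  obtain ⟨ρ, hρ, hball⟩ := Metric.eventually_nhds_iff.1
    (hlim.eventually (lt_mem_nhds (Real.rpow_pos_of_pos hc _)))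
  refine ⟨min r (ρ / 2), lt_min hr (by positivity), fun a ha hac => ?_⟩
  obtain ⟨p, rfl⟩ : ∃ p, a = c - p := ⟨c - a, by ring⟩
  have hp : 0 < p := by linarith
  have hp1 : p ≤ min r (ρ / 2) := by linarith
  have h1 := hbound p 0 le_rfl hp.le (hp1.trans (min_le_left _ _))
  have h2 := hball (y := p) (by
    rw [Real.dist_eq, sub_zero, abs_of_pos hp]
    linarith [hp1.trans (min_le_right _ _)])
  have h3 := (abs_le.1 h1).2
  rw [add_zero] at h3
  unfold slopeFun
  have h4 := mul_pos (pow_pos hp 2) h2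
  nlinarith [mul_le_mul_of_nonneg_left h3 hα.le]

theorem isBigO_of_mul_right {ι : Type*} {l : Filter ι} {f g h : ι → ℝ}
    (hh : ∀ᶠ x in l, h x ≠ 0) (H : (fun x => f x * h x) =O[l] fun x => g x * h x) :
    f =O[l] g := by
  refine (H.mul (isBigO_refl (fun x => (h x)⁻¹) l)).congr' ?_ ?_ <;>
  · filter_upwards [hh] with x hx
    field_simp

theorem solution_expansion {ι : Type*} {l : Filter ι} {α c : ℝ} (hα : 0 < α) (hc : 0 < c)
    {p q η δ : ι → ℝ} (hp : Tendsto p l (𝓝 0)) (hq : ∀ᶠ x in l, 0 < q x ∧ q x < p x)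
    (hpq : ∀ᶠ x in l, p x ^ 2 - q x ^ 2 = α * η x * (c + q x))
    (hJ : ∀ᶠ x in l, gapInt α c (c - p x) (c + q x) = η x * (c + q x) ^ α)
    (hδ : ∀ᶠ x in l, 0 < δ x ∧ δ x ^ 3 = 3 / 4 * c ^ 2 * η x) :
    (fun x => q x - (δ x - α / (3 * c) * δ x ^ 2)) =O[l] (fun x => δ x ^ 3) ∧
    (fun x => p x - (δ x + α / (3 * c) * δ x ^ 2)) =O[l] (fun x => δ x ^ 3) := by
  have hp0 : ∀ᶠ x in l, p x ≠ 0 := hq.mono fun x hx => (hx.1.trans hx.2).ne'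
  have hδ0 : ∀ᶠ x in l, δ x ≠ 0 := hδ.mono fun x hx => hx.1.ne'
  have hp1 : p =O[l] (fun _ => (1 : ℝ)) := hp.isBigO_one ℝ
  have hpow {m n : ℕ} (hmn : n ≤ m) : (fun x => p x ^ m) =O[l] (fun x => p x ^ n) := by
    obtain ⟨k, rfl⟩ := Nat.exists_eq_add_of_le hmn
    simpa [pow_add] using (isBigO_refl (fun x => p x ^ n) l).mul (hp1.pow k)
  have hqp : q =O[l] p := by
    refine IsBigO.of_bound 1 (hq.mono fun x hx => ?_)
    rw [Real.norm_of_nonneg hx.1.le, Real.norm_of_nonneg (hx.1.trans hx.2).le]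
    linarith
  have hq0 : Tendsto q l (𝓝 0) := hqp.trans_tendsto hp
  have hcq : Tendsto (fun x => c + q x) l (𝓝 c) := by simpa using hq0.const_add c
  have hR : (fun x => gapInt α c (c - p x) (c + q x)
      - (c ^ (α - 2) * (p x ^ 2 * q x - q x ^ 3 / 3 + 2 * p x ^ 3 / 3)
        - (α - 2) * c ^ (α - 2 - 1) * (p x ^ 2 - q x ^ 2) ^ 2 / 4)) =O[l]
      (fun x => p x ^ 5) := by
    obtain ⟨C, hC, r, hr, hbound⟩ := exists_gapInt_expansion_bound α hc
    refine IsBigO.of_bound C ?_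
    filter_upwards [hq, hp.eventually (gt_mem_nhds hr)] with x hx hxr
    rw [Real.norm_eq_abs, Real.norm_of_nonneg (pow_nonneg (hx.1.trans hx.2).le 5)]
    exact hbound _ _ hx.1.le hx.2.le hxr.le
  set A := c ^ (α - 2)
  set B := (α - 2) * c ^ (α - 2 - 1)
  have hJO : (fun x => gapInt α c (c - p x) (c + q x)) =O[l] (fun x => p x ^ 3) := by
    have h1 : (fun x => p x ^ 2 * q x) =O[l] (fun x => p x ^ 3) :=
      ((isBigO_refl (fun x => p x ^ 2) l).mul hqp).congr_right fun x => by ring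
    have h2 : (fun x => (p x ^ 2 - q x ^ 2) ^ 2) =O[l] (fun x => p x ^ 3) :=
      ((((isBigO_refl (fun x => p x ^ 2) l).sub (hqp.pow 2)).pow 2).congr_right
        fun x => by ring).trans (hpow (m := 4) (n := 3) (by norm_num))
    have h3 := (((h1.sub ((hqp.pow 3).const_mul_left (1 / 3))).add
      ((isBigO_refl (fun x => p x ^ 3) l).const_mul_left (2 / 3))).const_mul_left A).sub
      (h2.const_mul_left (B / 4))
    refine ((hR.trans (hpow (n := 3) (by norm_num))).add h3).congr_left fun x => ?_
    ring
  have hηO : η =O[l] (fun x => p x ^ 3) := by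
    have h1 : (fun x => (c + q x) ^ (-α)) =O[l] (fun _ => (1 : ℝ)) :=
      (hcq.rpow_const (p := -α) (Or.inl hc.ne')).isBigO_one ℝ
    refine (hJO.mul h1).congr' ?_ (Eventually.of_forall fun x => mul_one _)
    filter_upwards [hJ, hcq.eventually (lt_mem_nhds hc)] with x hx hx0
    rw [hx, mul_assoc, ← Real.rpow_add hx0]
    simp
  have htO : (fun x => p x ^ 2 - q x ^ 2) =O[l] (fun x => p x ^ 3) := by
    have h := (hηO.const_mul_left α).mul (hcq.isBigO_one ℝ)
    exact h.congr' (hpq.mono fun x hx => hx.symm) (Eventually.of_forall fun x => mul_one _)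
  have hdO : (fun x => p x - q x) =O[l] (fun x => p x ^ 2) := by
    refine isBigO_of_mul_right hp0 (IsBigO.trans ?_ (htO.congr_right fun x => by ring))
    refine IsBigO.of_bound 1 (hq.mono fun x hx => ?_)
    rw [Real.norm_of_nonneg (mul_nonneg (by linarith) (by linarith)),
      Real.norm_of_nonneg (by nlinarith)]
    nlinarith
  have hmain : (fun x => gapInt α c (c - p x) (c + q x) - A * (4 / 3 * p x ^ 3)) =O[l]
      (fun x => p x ^ 5) := by
    have h1 : (fun x => (p x - q x) ^ 2 * (2 * p x + q x)) =O[l] (fun x => p x ^ 5) :=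
      ((hdO.pow 2).mul (((isBigO_refl p l).const_mul_left 2).add hqp)).congr_right
        fun x => by ring
    have h2 : (fun x => (p x ^ 2 - q x ^ 2) ^ 2) =O[l] (fun x => p x ^ 5) :=
      ((htO.pow 2).congr_right fun x => by ring).trans (hpow (m := 6) (by norm_num))
    refine ((hR.sub (h1.const_mul_left (A / 3))).sub (h2.const_mul_left (B / 4))).congr_left
      fun x => ?_
    ring
  have hX : (fun x => δ x ^ 3 * (1 + α / c * p x) - p x ^ 3) =O[l] (fun x => p x ^ 5) := by
    have h1 : (fun x => η x * ((c + q x) ^ α - c ^ α - α * c ^ (α - 1) * q x)) =O[l]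
        (fun x => p x ^ 5) :=
      (hηO.mul (((add_rpow_sub_isBigO hc α).comp_tendsto hq0).trans (hqp.pow 2))).congr_right
        fun x => by ring
    have h2 : (fun x => η x * (p x - q x)) =O[l] (fun x => p x ^ 5) :=
      (hηO.mul hdO).congr_right fun x => by ring
    refine (((hmain.sub h1).add (h2.const_mul_left (α * c ^ (α - 1)))).const_mul_left
      (3 / 4 * c ^ 2 * (c ^ α)⁻¹)).congr' ?_ EventuallyEq.rfl
    filter_upwards [hJ, hδ] with x hx hx'
    have hcα : c ^ α ≠ 0 := (Real.rpow_pos_of_pos hc α).ne'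
    have eA : A = c ^ α / c ^ 2 := by
      simp only [A]
      rw [Real.rpow_sub hc, Real.rpow_two]
    have eB : c ^ (α - 1) = c ^ α / c := Real.rpow_sub_one hc.ne' α
    rw [hx, hx'.2, eA, eB]
    field_simp
    ring
  have hrO : (fun x => p x - δ x) =O[l] (fun x => p x ^ 2) := by
    have h1 : (fun x => p x ^ 3 - δ x ^ 3) =O[l] (fun x => p x ^ 4) := by
      have h2 : (fun x => η x * p x) =O[l] (fun x => p x ^ 4) :=
        (hηO.mul (isBigO_refl p l)).congr_right fun x => by ring
      refine ((h2.const_mul_left (3 / 4 * c ^ 2 * (α / c))).sub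
        (hX.trans (hpow (m := 5) (n := 4) (by norm_num)))).congr' ?_ EventuallyEq.rfl
      filter_upwards [hδ] with x hx
      rw [hx.2]
      ring
    refine isBigO_of_mul_right (hp0.mono fun x hx => pow_ne_zero 2 hx)
      (IsBigO.trans ?_ (h1.congr_right fun x => by ring))
    refine IsBigO.of_bound 1 ?_
    filter_upwards [hq, hδ] with x hx hx'
    have hpx := hx.1.trans hx.2
    rw [show p x ^ 3 - δ x ^ 3 = (p x - δ x) * (p x ^ 2 + (p x * δ x + δ x ^ 2)) by ring,
      norm_mul, norm_mul, one_mul]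
    refine mul_le_mul_of_nonneg_left ?_ (norm_nonneg _)
    have := mul_pos hpx hx'.1
    rw [Real.norm_of_nonneg (by positivity), Real.norm_of_nonneg (by positivity)]
    nlinarith [sq_nonneg (δ x)]
  have hpδ : p =O[l] δ := by
    have h1 : (fun x => p x ^ 2) =o[l] p := by
      simpa [pow_two] using (isBigO_refl p l).mul_isLittleO ((isLittleO_one_iff ℝ).2 hp)
    exact (hrO.trans_isLittleO h1).right_isBigO_sub.congr_right fun x => by ring
  have hpn (n : ℕ) : (fun x => p x ^ n) =O[l] (fun x => δ x ^ n) := hpδ.pow n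
  have hδp : δ =O[l] p :=
    (((isBigO_refl p l).sub (hrO.trans ((hpow (m := 2) (n := 1) (by norm_num)).congr_right
      fun x => pow_one _))).congr_left fun x => by ring)
  have hp3 : (fun x => (p x - δ x) - α / (3 * c) * δ x ^ 2) =O[l] (fun x => δ x ^ 3) := by
    refine isBigO_of_mul_right (h := fun x => δ x ^ 2) (hδ0.mono fun x hx => pow_ne_zero 2 hx)
      (IsBigO.trans ?_ ((hpn 5).congr_right fun x => by ring))
    have h1 : (fun x => δ x * (p x - δ x) ^ 2) =O[l] (fun x => p x ^ 5) :=
      (hδp.mul (hrO.pow 2)).congr_right fun x => by ring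
    have h2 : (fun x => (p x - δ x) ^ 3) =O[l] (fun x => p x ^ 5) :=
      ((hrO.pow 3).congr_right fun x => by ring).trans (hpow (m := 6) (by norm_num))
    have h3 : (fun x => δ x ^ 3 * (p x - δ x)) =O[l] (fun x => p x ^ 5) :=
      ((hδp.pow 3).mul hrO).congr_right fun x => by ring
    refine ((((h3.const_mul_left (α / c)).sub hX).sub (h1.const_mul_left 3)).sub
      h2).const_mul_left (1 / 3) |>.congr_left fun x => ?_
    field_simp
    ring
  have hd3 : (fun x => (p x - q x) - 2 * α / (3 * c) * δ x ^ 2) =O[l] (fun x => δ x ^ 3) := by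
    refine isBigO_of_mul_right (h := δ) hδ0
      (IsBigO.trans ?_ ((hpn 4).congr_right fun x => by ring))
    have h1 : (fun x => (p x - q x) ^ 2) =O[l] (fun x => p x ^ 4) :=
      (hdO.pow 2).congr_right fun x => by ring
    have h2 : (fun x => η x * q x) =O[l] (fun x => p x ^ 4) :=
      (hηO.mul hqp).congr_right fun x => by ring
    have h3 : (fun x => (p x - δ x) * (p x - q x)) =O[l] (fun x => p x ^ 4) :=
      (hrO.mul hdO).congr_right fun x => by ring
    refine ((((h1.const_mul_left (1 / 2)).add (h2.const_mul_left (α / 2))).sub h3)).congr' ?_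
      EventuallyEq.rfl
    filter_upwards [hpq, hδ] with x hx hx'
    have e : 2 * α / (3 * c) * δ x ^ 3 = α * η x * c / 2 := by
      rw [hx'.2]
      field_simp
      ring
    linear_combination (-1 / 2) * hx + e
  refine ⟨(hp3.sub hd3).congr_left fun x => ?_, hp3.congr_left fun x => ?_⟩
  · field_simp
    ring
  · ring

theorem rpow_one_third_pow_three {x : ℝ} (hx : 0 ≤ x) : (x ^ ((1 : ℝ) / 3)) ^ 3 = x := by
  rw [← Real.rpow_natCast, ← Real.rpow_mul hx]
  norm_num

theorem hFun_sub_hFun (γ σ c u a : ℝ) :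
    hFun γ σ c u - hFun γ σ c a = γ * σ ^ 2 / 2 * ((u - a) * (2 * c - a - u)) := by
  unfold hFun
  ring

theorem hInt_eq_gapInt (γ σ μ c a b : ℝ) :
    hInt γ σ μ c a b = γ * σ ^ 2 / 2 * gapInt (2 * μ / σ ^ 2) c a b := by
  rw [hInt, gapInt, ← intervalIntegral.integral_const_mul]
  refine intervalIntegral.integral_congr fun u _ => ?_
  simp only [hFun_sub_hFun]
  ring

theorem hInt_eq_cost_iff {γ σ : ℝ} (μ c a : ℝ) {b ε : ℝ} (hγ : 0 < γ) (hσ : 0 < σ) (hb : 0 < b) :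
    hInt γ σ μ c a b = ε * σ ^ 2 / 2 * b ^ (2 * μ / σ ^ 2) ↔
      b ^ (-(2 * μ / σ ^ 2)) * gapInt (2 * μ / σ ^ 2) c a b = ε / γ := by
  have hpos := Real.rpow_pos_of_pos hb (2 * μ / σ ^ 2)
  rw [hInt_eq_gapInt, Real.rpow_neg hb.le]
  generalize gapInt (2 * μ / σ ^ 2) c a b = J
  generalize b ^ (2 * μ / σ ^ 2) = B at *
  rw [inv_mul_eq_div, div_eq_div_iff hpos.ne' hγ.ne']
  have hσ2 : σ ^ 2 / 2 ≠ 0 := by positivity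
  constructor <;> intro h
  · refine mul_left_cancel₀ hσ2 ?_
    linear_combination h
  · linear_combination σ ^ 2 / 2 * h

theorem hInt_eq_slope_iff {γ σ μ : ℝ} (c a b : ℝ) (hγ : 0 < γ) (hσ : 0 < σ) (hμ : 0 < μ) :
    hInt γ σ μ c a b = b ^ (2 * μ / σ ^ 2 - 1) / (2 * μ / σ ^ 2) *
        (hFun γ σ c b - hFun γ σ c a) ↔ slopeFun (2 * μ / σ ^ 2) c a b = 0 := by
  have hα : 0 < 2 * μ / σ ^ 2 := by positivity
  have hk : γ * σ ^ 2 / 2 ≠ 0 := by positivity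
  rw [hInt_eq_gapInt, hFun_sub_hFun, slopeFun]
  generalize 2 * μ / σ ^ 2 = α at *
  rw [div_mul_eq_mul_div (b ^ (α - 1)), eq_div_iff hα.ne', sub_eq_zero]
  constructor <;> intro h
  · refine mul_left_cancel₀ hk ?_
    linear_combination -h
  · linear_combination -(γ * σ ^ 2 / 2) * h

theorem slope_coeff_eq {γ σ μ c : ℝ} (hγ : 0 < γ) (hσ : 0 < σ) (hc : 0 < c) {ε : ℝ}
    (hε : 0 < ε) :
    2 * μ / σ ^ 2 / (3 * c) *
        ((3 * c ^ 2 / (4 * γ)) ^ ((1 : ℝ) / 3) * ε ^ ((1 : ℝ) / 3)) ^ 2 =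
      (γ * c / 6) ^ ((1 : ℝ) / 3) * (μ / (γ * σ ^ 2)) * ε ^ ((2 : ℝ) / 3) := by
  have hε2 : ε ^ ((2 : ℝ) / 3) = (ε ^ ((1 : ℝ) / 3)) ^ 2 := by
    rw [← Real.rpow_natCast, ← Real.rpow_mul hε.le]
    norm_num
  have hX := rpow_one_third_pow_three (x := 3 * c ^ 2 / (4 * γ)) (by positivity)
  have hZ := rpow_one_third_pow_three (x := γ * c / 6) (by positivity)
  have hX0 : 0 ≤ (3 * c ^ 2 / (4 * γ)) ^ ((1 : ℝ) / 3) := by positivity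
  have hZ0 : 0 ≤ (γ * c / 6) ^ ((1 : ℝ) / 3) := by positivity
  rw [hε2]
  generalize (3 * c ^ 2 / (4 * γ)) ^ ((1 : ℝ) / 3) = X at *
  generalize (γ * c / 6) ^ ((1 : ℝ) / 3) = Z at *
  have hXZ : X ^ 2 * (2 * γ / (3 * c)) = Z := by
    refine (pow_left_inj₀ (by positivity) hZ0 three_ne_zero).1 ?_
    rw [hZ, show (X ^ 2 * (2 * γ / (3 * c))) ^ 3 = (X ^ 3) ^ 2 * (2 * γ / (3 * c)) ^ 3 by ring, hX]
    field_simp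
    norm_num
  rw [← hXZ]
  field_simp

theorem exists_solution {α c : ℝ} (hα : 0 < α) (hc : 0 < c) {e : ℝ} (he : 0 < e) :
    ∃ η₀ > 0, ∀ η, 0 < η → η < η₀ → ∃ a b, 0 < a ∧ c - e < a ∧ a < c ∧ c < b ∧
      slopeFun α c a b = 0 ∧ b ^ (-α) * gapInt α c a b = η := by
  obtain ⟨r, hr, hslope⟩ := exists_slopeFun_pos hα hc
  obtain ⟨ρ, hρ, hρ'⟩ := exists_between (lt_min hr (lt_min hc he))
  obtain ⟨h1, h2, h3⟩ : ρ < r ∧ ρ < c ∧ ρ < e := by simpa using hρ'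
  refine ⟨c ^ (-α) * gapInt α c (c - ρ) c, mul_pos (Real.rpow_pos_of_pos hc _)
    (gapInt_pos α (by linarith) (by linarith) (by linarith)), fun η hη hη' => ?_⟩
  obtain ⟨a, b, ha, hac, hcb, hs, hV⟩ := exists_solution_of_slopeFun_pos hα hρ h2
    (fun a ha hac => hslope a (by linarith) hac) hη hη'.le
  exact ⟨a, b, by linarith, by linarith, hac, hcb, hs, hV⟩

/-- For small `ε > 0` the smooth-pasting system for the log-contract hedging
boundaries has a unique solution `(y₋(ε), y₊(ε))` with `0 < y₋ < y⋆ < y₊`, and the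
boundaries admit the stated asymptotic expansion as `ε → 0⁺`. -/
theorem stmt11
    (γ σ μ ystar : ℝ) (hγ : 0 < γ) (hσ : 0 < σ) (hμ : 0 < μ) (hy : 0 < ystar) :
    ∃ ε₀ > (0:ℝ), ∃ yminus yplus : ℝ → ℝ,
      (∀ ε ∈ Set.Ioo (0:ℝ) ε₀,
        (0 < yminus ε ∧ yminus ε < ystar ∧ ystar < yplus ε) ∧
        hInt γ σ μ ystar (yminus ε) (yplus ε)
          = ε * σ ^ 2 / 2 * yplus ε ^ (2 * μ / σ ^ 2) ∧
        hInt γ σ μ ystar (yminus ε) (yplus ε)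
          = yplus ε ^ (2 * μ / σ ^ 2 - 1) / (2 * μ / σ ^ 2) *
              (hFun γ σ ystar (yplus ε) - hFun γ σ ystar (yminus ε)) ∧
        (∀ a b : ℝ, (0 < a ∧ a < ystar ∧ ystar < b) →
          hInt γ σ μ ystar a b = ε * σ ^ 2 / 2 * b ^ (2 * μ / σ ^ 2) →
          hInt γ σ μ ystar a b = b ^ (2 * μ / σ ^ 2 - 1) / (2 * μ / σ ^ 2) *
              (hFun γ σ ystar b - hFun γ σ ystar a) →
          a = yminus ε ∧ b = yplus ε)) ∧
      ((fun ε => yplus ε -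
          (ystar + (3 * ystar ^ 2 / (4 * γ)) ^ ((1:ℝ)/3) * ε ^ ((1:ℝ)/3) -
            (γ * ystar / 6) ^ ((1:ℝ)/3) * (μ / (γ * σ ^ 2)) * ε ^ ((2:ℝ)/3)))
        =O[𝓝[>] (0:ℝ)] fun ε => ε) ∧
      ((fun ε => yminus ε -
          (ystar - (3 * ystar ^ 2 / (4 * γ)) ^ ((1:ℝ)/3) * ε ^ ((1:ℝ)/3) -
            (γ * ystar / 6) ^ ((1:ℝ)/3) * (μ / (γ * σ ^ 2)) * ε ^ ((2:ℝ)/3)))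
        =O[𝓝[>] (0:ℝ)] fun ε => ε) := by
  have hα : 0 < 2 * μ / σ ^ 2 := by positivity
  obtain ⟨η₀, hη₀, hsol⟩ := exists_solution hα hy hy
  have hsol' : ∀ ε : ℝ, ∃ a b : ℝ, ε ∈ Set.Ioo 0 (γ * η₀) → 0 < a ∧ a < ystar ∧ ystar < b ∧
      slopeFun (2 * μ / σ ^ 2) ystar a b = 0 ∧
      b ^ (-(2 * μ / σ ^ 2)) * gapInt (2 * μ / σ ^ 2) ystar a b = ε / γ := fun ε => by
    by_cases hε : ε ∈ Set.Ioo 0 (γ * η₀)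
    · obtain ⟨a, b, ha, -, h⟩ := hsol (ε / γ) (div_pos hε.1 hγ)
        ((div_lt_iff₀' hγ).2 hε.2)
      exact ⟨a, b, fun _ => ⟨ha, h⟩⟩
    · exact ⟨0, 0, fun h => absurd h hε⟩
  choose yminus yplus hsys using hsol'
  have hev : ∀ᶠ ε in 𝓝[>] (0 : ℝ), ε ∈ Set.Ioo 0 (γ * η₀) := Ioo_mem_nhdsGT (by positivity)
  have hlim : Tendsto (fun ε => ystar - yminus ε) (𝓝[>] (0 : ℝ)) (𝓝 0) := by
    refine Metric.tendsto_nhds.2 fun e he => ?_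
    obtain ⟨η₁, hη₁, hclose⟩ := exists_solution hα hy he
    filter_upwards [hev, Ioo_mem_nhdsGT (by positivity : 0 < γ * η₁)] with ε hε hε'
    obtain ⟨a, b, ha, hae, hac, hcb, hs, hV⟩ := hclose (ε / γ) (div_pos hε.1 hγ)
      ((div_lt_iff₀' hγ).2 hε'.2)
    obtain ⟨ha', hac', hcb', hs', hV'⟩ := hsys ε hε
    have := (eq_of_slopeFun_eq_zero _ ha hac ha' hac' hcb hcb' hs hs' (hV.trans hV'.symm)).1
    rw [Real.dist_eq, sub_zero, abs_of_pos (by linarith)]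
    linarith
  have hcost : ∀ ε ∈ Set.Ioo 0 (γ * η₀), gapInt (2 * μ / σ ^ 2) ystar (yminus ε) (yplus ε) =
      ε / γ * yplus ε ^ (2 * μ / σ ^ 2) := fun ε hε => by
    obtain ⟨-, -, hcb, -, hV⟩ := hsys ε hε
    rw [← hV, mul_right_comm, ← Real.rpow_add (hy.trans hcb)]
    simp
  have hgap : ∀ ε ∈ Set.Ioo 0 (γ * η₀), (ystar - yminus ε) ^ 2 - (yplus ε - ystar) ^ 2 =
      2 * μ / σ ^ 2 * (ε / γ) * yplus ε := fun ε hε => by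
    obtain ⟨-, -, hcb, hs, -⟩ := hsys ε hε
    have hb := hy.trans hcb
    rw [slopeFun, hcost ε hε, Real.rpow_sub_one hb.ne'] at hs
    have hpos := Real.rpow_pos_of_pos hb (2 * μ / σ ^ 2)
    generalize yplus ε ^ (2 * μ / σ ^ 2) = B at *
    generalize 2 * μ / σ ^ 2 = α at *
    refine mul_left_cancel₀ (div_ne_zero hpos.ne' hb.ne') ?_
    have e : B / yplus ε * yplus ε = B := div_mul_cancel₀ _ hb.ne'
    linear_combination hs - α * (ε / γ) * e
  obtain ⟨hplus, hminus⟩ := solution_expansion (l := 𝓝[>] (0 : ℝ)) hα hy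
    (p := fun ε => ystar - yminus ε) (q := fun ε => yplus ε - ystar) (η := fun ε => ε / γ)
    (δ := fun ε => (3 * ystar ^ 2 / (4 * γ)) ^ ((1 : ℝ) / 3) * ε ^ ((1 : ℝ) / 3)) hlim
    (hev.mono fun ε hε => by
      obtain ⟨ha, hac, hcb, -, -⟩ := hsys ε hε
      refine ⟨sub_pos.2 hcb, abs_lt_of_sq_lt_sq' ?_ (sub_pos.2 hac).le |>.2⟩
      have := hgap ε hε
      have : 0 < 2 * μ / σ ^ 2 * (ε / γ) * yplus ε :=
        mul_pos (mul_pos hα (div_pos hε.1 hγ)) (hy.trans hcb)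
      linarith)
    (hev.mono fun ε hε => by
      rw [hgap ε hε]
      ring)
    (hev.mono fun ε hε => by
      rw [sub_sub_cancel, add_sub_cancel]
      exact hcost ε hε)
    (hev.mono fun ε hε => by
      have := hε.1
      refine ⟨by positivity, ?_⟩
      rw [mul_pow, rpow_one_third_pow_three (by positivity), rpow_one_third_pow_three hε.1.le]
      field_simp)
  have hδ : (fun ε : ℝ => ((3 * ystar ^ 2 / (4 * γ)) ^ ((1 : ℝ) / 3) * ε ^ ((1 : ℝ) / 3)) ^ 3)
      =O[𝓝[>] (0 : ℝ)] fun ε => ε := by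
    refine ((isBigO_refl (fun ε : ℝ => ε) _).const_mul_left (3 * ystar ^ 2 / (4 * γ))).congr'
      (hev.mono fun ε hε => ?_) EventuallyEq.rfl
    simp only
    rw [mul_pow, rpow_one_third_pow_three (by positivity), rpow_one_third_pow_three hε.1.le]
  refine ⟨γ * η₀, by positivity, yminus, yplus, fun ε hε => ?_, ?_, ?_⟩
  · obtain ⟨ha, hac, hcb, hs, hV⟩ := hsys ε hε
    refine ⟨⟨ha, hac, hcb⟩, (hInt_eq_cost_iff _ _ _ hγ hσ (hy.trans hcb)).2 hV,
      (hInt_eq_slope_iff _ _ _ hγ hσ hμ).2 hs, fun a b hab h1 h2 => ?_⟩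
    obtain ⟨ha', hac', hcb'⟩ := hab
    rw [hInt_eq_cost_iff _ _ _ hγ hσ (hy.trans hcb')] at h1
    rw [hInt_eq_slope_iff _ _ _ hγ hσ hμ] at h2
    exact eq_of_slopeFun_eq_zero _ ha' hac' ha hac hcb' hcb h2 hs (h1.trans hV.symm)
  · refine (hplus.trans hδ).congr' (hev.mono fun ε hε => ?_) EventuallyEq.rfl
    simp only
    rw [slope_coeff_eq hγ hσ hy hε.1]
    ring
  · refine (hminus.trans hδ).neg_left.congr' (hev.mono fun ε hε => ?_) EventuallyEq.rfl
    simp only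
    rw [slope_coeff_eq hγ hσ hy hε.1]
    ring
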